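/- Restriction of a Lipschitz graph beta number to lines: Let f : ℝⁿ → ℝ be L-Lipschitz and suppose that for every line ℓ ⊂ ℝⁿ and every dyadic cube family, the one-dimensional Carleson estimate Σ_{Q ⊂ Q₀, CQ ∩ ℓ ≠ ∅} β_∞(CQ, ℓ)² diam(Q) ≤ K·L·diam(Q₀) holds. Then Σ_{Q ⊂ Q₀} β¹_{∞,2}(CQ)² |Q| ≤ C(K, C, n) · L · |Q₀| for every dyadic cube Q₀, where β¹_{∞,2}(CQ)² = (1/η₁(𝒜₁(CQ))) ∫_{𝒜₁(CQ)} β_∞(CQ, ℓ)² dη₁(ℓ). -/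

import Mathlib

open MeasureTheory
open scoped RealInnerProductSpace NNReal

/-- The half-open dyadic cube of generation `j` indexed by `k`. -/
def dyC (n : ℕ) (j : ℤ) (k : Fin n → ℤ) : Set (EuclideanSpace ℝ (Fin n)) :=
  {x | ∀ i, (k i : ℝ) * (2 : ℝ) ^ (-j) ≤ x i ∧ x i < ((k i : ℝ) + 1) * (2 : ℝ) ^ (-j)}

/-- The concentric dilate `CQ` of the dyadic cube `Q = dyC n j k`. -/
def dyCDil (n : ℕ) (C : ℝ) (j : ℤ) (k : Fin n → ℤ) : Set (EuclideanSpace ℝ (Fin n)) :=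
  {x | ∀ i, |x i - ((k i : ℝ) + 1 / 2) * (2 : ℝ) ^ (-j)| ≤ C * (2 : ℝ) ^ (-j) / 2}

/-- The affine line through `v` with direction `e`. -/
def lineThrough {n : ℕ} (e v : EuclideanSpace ℝ (Fin n)) : Set (EuclideanSpace ℝ (Fin n)) :=
  {x | ∃ r : ℝ, x = v + r • e}

/-- `β_∞(S, ℓ)`: the infimum over affine maps `A : ℝⁿ → ℝ` of
`sup_{x ∈ S ∩ ℓ} |f x − A x| / diam S`. -/
noncomputable def betaInfLine {n : ℕ} (f : EuclideanSpace ℝ (Fin n) → ℝ)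
    (S ℓ' : Set (EuclideanSpace ℝ (Fin n))) : ℝ :=
  sInf {r : ℝ | ∃ A : EuclideanSpace ℝ (Fin n) →ᵃ[ℝ] ℝ,
    r = ⨆ x ∈ S ∩ ℓ', |f x - A x| / Metric.diam S}

/-- `η₁(𝒜₁(S))` via the integral-geometric parametrisation of lines by a unit direction
`e` and a point `v ∈ e^⊥`. -/
noncomputable def etaLines {n : ℕ} (S : Set (EuclideanSpace ℝ (Fin n))) : ℝ :=
  ∫ e in {e : EuclideanSpace ℝ (Fin n) | ‖e‖ = 1},
    (μH[(n : ℝ) - 1] {v : EuclideanSpace ℝ (Fin n) |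
      ⟪v, e⟫ = 0 ∧ (S ∩ lineThrough e v).Nonempty}).toReal ∂μH[(n : ℝ) - 1]

/-- `∫_{𝒜₁(S)} β_∞(S, ℓ)² dη₁(ℓ)` in the same parametrisation. -/
noncomputable def lineBetaInt {n : ℕ} (f : EuclideanSpace ℝ (Fin n) → ℝ)
    (S : Set (EuclideanSpace ℝ (Fin n))) : ℝ :=
  ∫ e in {e : EuclideanSpace ℝ (Fin n) | ‖e‖ = 1},
    (∫ v in {v : EuclideanSpace ℝ (Fin n) |
        ⟪v, e⟫ = 0 ∧ (S ∩ lineThrough e v).Nonempty},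
      betaInfLine f S (lineThrough e v) ^ 2 ∂μH[(n : ℝ) - 1]) ∂μH[(n : ℝ) - 1]


namespace BetaAux

local notation "EE" n => EuclideanSpace ℝ (Fin n)

/-- closed description of the line -/
def cl {n : ℕ} (p : (EE n) × (EE n)) : Set (EE n) :=
  {x | x = p.2 + ⟪x - p.2, p.1⟫ • p.1}

lemma cl_eq {n : ℕ} (e v : EE n) (he : ‖e‖ = 1) : lineThrough e v = cl (e, v) := by
  ext x
  simp only [lineThrough, cl, Set.mem_setOf_eq]
  constructor
  · rintro ⟨r, rfl⟩
    simp [inner_smul_left, he]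
  · intro h
    exact ⟨_, h⟩

lemma isClosed_ex {n : ℕ} (S T : Set (EE n)) (hS : IsCompact S) (hT : IsClosed T) :
    IsClosed {p : (EE n) × (EE n) | ∃ x ∈ S ∩ cl p, x ∈ T} := by
  haveI : CompactSpace S := isCompact_iff_compactSpace.1 hS
  have h1 : IsClosed {q : ((EE n) × (EE n)) × S |
      (q.2 : EE n) = q.1.2 + ⟪(q.2 : EE n) - q.1.2, q.1.1⟫ • q.1.1 ∧ (q.2 : EE n) ∈ T} := by
    apply IsClosed.inter
    · exact isClosed_eq (by fun_prop) (by fun_prop)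
    · exact hT.preimage (by fun_prop)
  have h2 := isClosedMap_fst_of_compactSpace _ h1
  convert h2 using 1
  ext p
  simp only [Set.mem_setOf_eq, Set.mem_image, Prod.exists, Subtype.exists, cl]
  constructor
  · rintro ⟨x, ⟨hx, hl⟩, ht⟩
    exact ⟨p.1, p.2, x, hx, ⟨hl, ht⟩, rfl⟩
  · rintro ⟨a, b, x, hx, ⟨hl, ht⟩, rfl⟩
    exact ⟨x, ⟨hx, hl⟩, ht⟩

lemma isClosed_cl {n : ℕ} (p : (EE n) × (EE n)) : IsClosed (cl p) :=
  isClosed_eq (by fun_prop) (by fun_prop)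

lemma iSup_lt {α : Type*} [TopologicalSpace α] (T : Set α) (hT : IsCompact T) (g : α → ℝ)
    (hg : Continuous g) (hg0 : ∀ x, 0 ≤ g x) (c : ℝ) (hc : 0 < c) :
    (⨆ x ∈ T, g x) < c ↔ ∀ x ∈ T, g x < c := by
  have hb : BddAbove (Set.range fun x => ⨆ (_ : x ∈ T), g x) := by
    obtain ⟨M, hM⟩ := hT.bddAbove_image hg.continuousOn
    refine ⟨max M 0, ?_⟩
    rintro _ ⟨x, rfl⟩
    by_cases hx : x ∈ T
    · simp only [hx, ciSup_unique]
      exact le_max_of_le_left (hM ⟨x, hx, rfl⟩)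
    · simp [hx]
  constructor
  · intro h x hx
    refine lt_of_le_of_lt ?_ h
    have := le_ciSup hb x
    simpa [hx] using this
  · intro h
    rcases T.eq_empty_or_nonempty with rfl | hne
    · simpa using hc
    · obtain ⟨x, hx, hmax⟩ := hT.exists_isMaxOn hne hg.continuousOn
      refine lt_of_le_of_lt ?_ (h x hx)
      haveI : Nonempty α := ⟨x⟩
      refine ciSup_le fun y => ?_
      by_cases hy : y ∈ T
      · simp only [hy, ciSup_unique]
        exact hmax hy
      · simpa [hy] using hg0 x

lemma beta_nonneg {n : ℕ} (f : (EE n) → ℝ) (S l : Set (EE n)) : 0 ≤ betaInfLine f S l := by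
  apply Real.sInf_nonneg
  rintro _ ⟨A, rfl⟩
  exact Real.iSup_nonneg fun x => Real.iSup_nonneg fun _ => by positivity

lemma beta_lt {n : ℕ} (f : (EE n) → ℝ) (S l : Set (EE n)) (c : ℝ) :
    betaInfLine f S l < c ↔ ∃ A : (EE n) →ᵃ[ℝ] ℝ,
      (⨆ x ∈ S ∩ l, |f x - A x| / Metric.diam S) < c := by
  unfold betaInfLine
  rw [csInf_lt_iff]
  · constructor
    · rintro ⟨_, ⟨A, rfl⟩, h⟩
      exact ⟨A, h⟩
    · rintro ⟨A, h⟩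
      exact ⟨_, ⟨A, rfl⟩, h⟩
  · refine ⟨0, ?_⟩
    rintro _ ⟨A, rfl⟩
    exact Real.iSup_nonneg fun x => Real.iSup_nonneg fun _ => by positivity
  · exact ⟨_, 0, rfl⟩

lemma beta_le {n : ℕ} (f : (EE n) → ℝ) (L : ℝ≥0) (hf : LipschitzWith L f) (S l : Set (EE n))
    (hS : Bornology.IsBounded S) (hne : S.Nonempty) : betaInfLine f S l ≤ L := by
  obtain ⟨x0, hx0⟩ := hne
  apply csInf_le_of_le (b := ⨆ x ∈ S ∩ l, |f x - (AffineMap.const ℝ (EE n) (f x0)) x| / Metric.diam S)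
  · refine ⟨0, ?_⟩
    rintro _ ⟨A, rfl⟩
    exact Real.iSup_nonneg fun x => Real.iSup_nonneg fun _ => by positivity
  · exact ⟨_, rfl⟩
  · refine Real.iSup_le (fun x => Real.iSup_le (fun hx => ?_) L.2) L.2
    have h1 : |f x - f x0| ≤ L * Metric.diam S := by
      have := hf.dist_le_mul x x0
      rw [Real.dist_eq] at this
      exact this.trans (by gcongr; exact Metric.dist_le_diam_of_mem hS hx.1 hx0)
    simp only [AffineMap.const_apply]
    exact div_le_of_le_mul₀ Metric.diam_nonneg L.2 h1

lemma beta_meas {n : ℕ} (f : (EE n) → ℝ) (hf : Continuous f) (S : Set (EE n)) (hS : IsCompact S) :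
    Measurable fun p : (EE n) × (EE n) => betaInfLine f S (cl p) := by
  apply measurable_of_Iio
  intro c
  rcases le_or_gt c 0 with hc | hc
  · convert MeasurableSet.empty
    ext p
    simpa using hc.trans (beta_nonneg f S (cl p))
  · apply IsOpen.measurableSet
    have : (fun p : (EE n) × (EE n) => betaInfLine f S (cl p)) ⁻¹' Set.Iio c =
        ⋃ A : (EE n) →ᵃ[ℝ] ℝ, {p : (EE n) × (EE n) |
          ∃ x ∈ S ∩ cl p, x ∈ {x | c ≤ |f x - A x| / Metric.diam S}}ᶜ := by
      ext p
      simp only [Set.mem_preimage, Set.mem_Iio, Set.mem_iUnion, beta_lt]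
      refine exists_congr fun A => ?_
      have hA : Continuous A := A.continuous_of_finiteDimensional
      rw [iSup_lt (S ∩ cl p) (hS.inter_right (isClosed_cl p)) _ (by fun_prop)
        (fun x => by positivity) c hc]
      simp
    rw [this]
    refine isOpen_iUnion fun A => ?_
    have hA : Continuous A := A.continuous_of_finiteDimensional
    exact (isClosed_ex S _ hS (isClosed_le continuous_const (by fun_prop))).isOpen_compl

lemma hyper_eq {n : ℕ} (e : EE n) :
    {v : EE n | ⟪v, e⟫ = 0} = Set.range ((ℝ ∙ e)ᗮ.subtypeₗᵢ) := by
  ext v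
  simp [Submodule.mem_orthogonal_singleton_iff_inner_left]

lemma restrict_hyper {m : ℕ} (e : EE (m + 1)) :
    (μH[(m : ℝ)]).restrict {v : EE (m + 1) | ⟪v, e⟫ = 0} =
      Measure.map ((ℝ ∙ e)ᗮ.subtypeₗᵢ) (μH[(m : ℝ)]) := by
  rw [hyper_eq, ((ℝ ∙ e)ᗮ.subtypeₗᵢ).isometry.map_hausdorffMeasure (Or.inl (by positivity))]

lemma haar_hyper {m : ℕ} (e : EE (m + 1)) (he : ‖e‖ = 1) :
    (μH[(m : ℝ)] : Measure (ℝ ∙ e)ᗮ).IsAddHaarMeasure := by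
  haveI : Fact (Module.finrank ℝ (EE (m + 1)) = m + 1) := ⟨by simp⟩
  have h := Submodule.finrank_orthogonal_span_singleton (𝕜 := ℝ) (n := m) (v := e)
    (by rintro rfl; simp at he)
  have := isAddHaarMeasure_hausdorffMeasure (E := (ℝ ∙ e)ᗮ)
  rwa [h] at this

lemma sfinite_hyper {m : ℕ} (e : EE (m + 1)) (he : ‖e‖ = 1) :
    SFinite ((μH[(m : ℝ)]).restrict {v : EE (m + 1) | ⟪v, e⟫ = 0}) := by
  haveI := haar_hyper e he
  rw [restrict_hyper]
  infer_instance

lemma ball_hyper {m : ℕ} (e : EE (m + 1)) (he : ‖e‖ = 1) (r : ℝ) :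
    ((μH[(m : ℝ)]).restrict {v : EE (m + 1) | ⟪v, e⟫ = 0}) (Metric.closedBall 0 r) < ⊤ := by
  haveI := haar_hyper e he
  rw [restrict_hyper, Measure.map_apply
    ((ℝ ∙ e)ᗮ.subtypeₗᵢ).continuous.measurable Metric.isClosed_closedBall.measurableSet]
  have : ((ℝ ∙ e)ᗮ.subtypeₗᵢ) ⁻¹' (Metric.closedBall 0 r) = Metric.closedBall 0 r := by
    ext x; simp
  rw [this]
  exact measure_closedBall_lt_top

lemma meas_param {m : ℕ} (φ : (EE (m + 1)) × (EE (m + 1)) → ENNReal) (hφ : Measurable φ) :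
    ∃ g : (EE (m + 1)) → ENNReal, Measurable g ∧ ∀ e, ‖e‖ = 1 →
      ∫⁻ v in {v : EE (m + 1) | ⟪v, e⟫ = 0}, φ (e, v) ∂μH[(m : ℝ)] = g e := by
  set e0 : EE (m + 1) := EuclideanSpace.single 0 1 with he0d
  have he0 : ‖e0‖ = 1 := by simp [he0d]
  haveI := sfinite_hyper e0 he0
  refine ⟨fun e => ∫⁻ w in {v : EE (m + 1) | ⟪v, e0⟫ = 0},
    φ (e, w - (2 * (⟪e0 - e, w⟫ / ‖e0 - e‖ ^ 2)) • (e0 - e)) ∂μH[(m : ℝ)], ?_, ?_⟩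
  · apply Measurable.lintegral_prod_right' (f := fun q : (EE (m + 1)) × (EE (m + 1)) =>
      φ (q.1, q.2 - (2 * (⟪e0 - q.1, q.2⟫ / ‖e0 - q.1‖ ^ 2)) • (e0 - q.1)))
    apply hφ.comp
    fun_prop
  · intro e he
    set R := (ℝ ∙ (e0 - e))ᗮ.reflection with hR
    have hRe : R e0 = e := Submodule.reflection_sub (he0.trans he.symm)
    have hRw : ∀ w, R w = w - (2 * (⟪e0 - e, w⟫ / ‖e0 - e‖ ^ 2)) • (e0 - e) := by
      intro w
      rw [hR, Submodule.reflection_orthogonal_apply, Submodule.reflection_singleton_apply]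
      simp [mul_smul, two_smul]
    have hmp : MeasurePreserving R (μH[(m : ℝ)]) (μH[(m : ℝ)]) :=
      R.toIsometryEquiv.measurePreserving_hausdorffMeasure (m : ℝ)
    have hs : MeasurableSet {v : EE (m + 1) | ⟪v, e⟫ = 0} :=
      (isClosed_eq (by fun_prop) (by fun_prop)).measurableSet
    have h3 := hmp.restrict_preimage hs
    have hpre : R ⁻¹' {v : EE (m + 1) | ⟪v, e⟫ = 0} = {v : EE (m + 1) | ⟪v, e0⟫ = 0} := by
      ext w
      simp only [Set.mem_preimage, Set.mem_setOf_eq]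
      rw [← R.inner_map_map w e0, hRe]
    rw [hpre] at h3
    rw [← h3.lintegral_comp (f := fun v => φ (e, v)) (by fun_prop)]
    simp only [hRw]

open scoped Pointwise

lemma dil_compact (n : ℕ) (C : ℝ) (j : ℤ) (k : Fin n → ℤ) : IsCompact (dyCDil n C j k) := by
  have h : IsCompact (Set.univ.pi fun i : Fin n =>
      Metric.closedBall (((k i : ℝ) + 1 / 2) * (2 : ℝ) ^ (-j)) (C * (2 : ℝ) ^ (-j) / 2)) :=
    isCompact_univ_pi fun i => isCompact_closedBall _ _
  have h2 := (EuclideanSpace.equiv (Fin n) ℝ).toHomeomorph.isCompact_preimage.2 h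
  convert h2 using 1
  ext x
  simp [dyCDil, Real.dist_eq]

lemma dil_nonempty (n : ℕ) (C : ℝ) (hC : 1 ≤ C) (j : ℤ) (k : Fin n → ℤ) :
    (dyCDil n C j k).Nonempty := by
  refine ⟨WithLp.toLp 2 fun i => ((k i : ℝ) + 1 / 2) * (2 : ℝ) ^ (-j), fun i => ?_⟩
  simp only [sub_self, abs_zero]
  positivity

/-- corner of the cube -/
noncomputable def corner (n : ℕ) (j : ℤ) (k : Fin n → ℤ) : EE n :=
  WithLp.toLp 2 fun i => (k i : ℝ) * (2 : ℝ) ^ (-j)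

lemma dil_eq (n : ℕ) (C : ℝ) (j : ℤ) (k : Fin n → ℤ) :
    dyCDil n C j k = corner n j k +ᵥ ((2 : ℝ) ^ (-j) • dyCDil n C 0 0) := by
  have hs : (0 : ℝ) < (2 : ℝ) ^ (-j) := by positivity
  ext x
  rw [Set.mem_vadd_set_iff_neg_vadd_mem, Set.mem_smul_set_iff_inv_smul_mem₀ hs.ne']
  simp only [dyCDil, Set.mem_setOf_eq]
  refine forall_congr' fun i => ?_
  have hc : corner n j k i = k i * (2 : ℝ) ^ (-j) := rfl
  simp only [PiLp.smul_apply, vadd_eq_add, PiLp.add_apply, PiLp.neg_apply, hc, smul_eq_mul]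
  generalize (2 : ℝ) ^ (-j) = s at *
  simp only [Pi.zero_apply, Int.cast_zero, neg_zero, zpow_zero, mul_one, zero_add]
  have e1 : x i - ((k i : ℝ) + 1 / 2) * s = s * (s⁻¹ * (-(k i * s) + x i) - 1 / 2) := by
    field_simp
    ring
  rw [e1, abs_mul, abs_of_pos hs, show C * s / 2 = s * (C / 2) by ring,
    mul_le_mul_iff_of_pos_left hs]

lemma dyC_eq (n : ℕ) (j : ℤ) (k : Fin n → ℤ) :
    dyC n j k = corner n j k +ᵥ ((2 : ℝ) ^ (-j) • dyC n 0 0) := by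
  have hs : (0 : ℝ) < (2 : ℝ) ^ (-j) := by positivity
  ext x
  rw [Set.mem_vadd_set_iff_neg_vadd_mem, Set.mem_smul_set_iff_inv_smul_mem₀ hs.ne']
  simp only [dyC, Set.mem_setOf_eq]
  refine forall_congr' fun i => ?_
  have hc : corner n j k i = k i * (2 : ℝ) ^ (-j) := rfl
  simp only [PiLp.smul_apply, vadd_eq_add, PiLp.add_apply, PiLp.neg_apply, hc, smul_eq_mul]
  generalize (2 : ℝ) ^ (-j) = s at *
  simp only [Pi.zero_apply, Int.cast_zero, zero_mul, neg_zero, zpow_zero, mul_one, zero_add]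
  rw [inv_mul_lt_iff₀ hs, le_inv_mul_iff₀ hs]
  constructor <;> rintro ⟨h1, h2⟩ <;> constructor <;> linarith

lemma diam_eq (n : ℕ) (j : ℤ) (k : Fin n → ℤ) :
    Metric.diam (dyC n j k) = (2 : ℝ) ^ (-j) * Metric.diam (dyC n 0 0) := by
  rw [dyC_eq, diam_vadd, diam_smul₀, Real.norm_of_nonneg (by positivity)]

lemma vol_eq (n : ℕ) (j : ℤ) (k : Fin n → ℤ) :
    (volume (dyC n j k)).toReal = ((2 : ℝ) ^ (-j)) ^ n * (volume (dyC n 0 0)).toReal := by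
  rw [dyC_eq, measure_vadd, Measure.addHaar_smul, ENNReal.toReal_mul,
    ENNReal.toReal_ofReal (abs_nonneg _), abs_of_nonneg (by positivity)]
  simp

lemma diam_pos (m : ℕ) : 0 < Metric.diam (dyC (m + 1) 0 0) := by
  have hb : Bornology.IsBounded (dyC (m + 1) 0 0) := by
    refine (dil_compact (m + 1) 1 0 0).isBounded.subset fun x hx i => ?_
    have := hx i
    simp at this ⊢
    rw [abs_le]; constructor <;> linarith
  have h0 : (0 : EE (m + 1)) ∈ dyC (m + 1) 0 0 := by intro i; simp
  have h1 : (EuclideanSpace.single 0 (1 / 2) : EE (m + 1)) ∈ dyC (m + 1) 0 0 := by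
    intro i
    by_cases h : i = 0
    · subst h; norm_num
    · simp [h]
  have := Metric.dist_le_diam_of_mem hb h1 h0
  refine lt_of_lt_of_le ?_ this
  simp

lemma sub_bounds {n : ℕ} {j j₀ : ℤ} {k k₀ : Fin n → ℤ} (h : dyC n j k ⊆ dyC n j₀ k₀) (i : Fin n) :
    (k₀ i : ℝ) * (2 : ℝ) ^ (-j₀) ≤ (k i : ℝ) * (2 : ℝ) ^ (-j) ∧
    ((k i : ℝ) + 1) * (2 : ℝ) ^ (-j) ≤ ((k₀ i : ℝ) + 1) * (2 : ℝ) ^ (-j₀) := by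
  have hs : (0 : ℝ) < (2 : ℝ) ^ (-j) := by positivity
  have key : ∀ t : ℝ, 0 ≤ t → t < 1 → (k₀ i : ℝ) * (2 : ℝ) ^ (-j₀) ≤ ((k i : ℝ) + t) * (2 : ℝ) ^ (-j) ∧
      ((k i : ℝ) + t) * (2 : ℝ) ^ (-j) < ((k₀ i : ℝ) + 1) * (2 : ℝ) ^ (-j₀) := by
    intro t ht0 ht1
    have hm : (WithLp.toLp 2 fun i => ((k i : ℝ) + t) * (2 : ℝ) ^ (-j) : EE n) ∈ dyC n j k := by
      intro i
      constructor
      · show _ ≤ ((k i : ℝ) + t) * (2 : ℝ) ^ (-j)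
        gcongr; linarith
      · show ((k i : ℝ) + t) * (2 : ℝ) ^ (-j) < _
        gcongr
    exact h hm i
  refine ⟨by simpa using (key 0 le_rfl one_pos).1, ?_⟩
  generalize (2 : ℝ) ^ (-j) = s at *
  refine le_of_forall_lt fun c hc => ?_
  by_cases hcc : c < k i * s
  · have := (key 0 le_rfl one_pos).2
    rw [add_zero] at this
    linarith
  · have := (key ((c - k i * s) / s) (div_nonneg (by linarith) hs.le)
      (by rw [div_lt_one hs]; linarith)).2
    have e : (k i + (c - k i * s) / s) * s = c := by field_simp; ring
    rwa [e] at this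

lemma dil_mono {n : ℕ} {C : ℝ} (hC : 1 ≤ C) {j j₀ : ℤ} {k k₀ : Fin n → ℤ}
    (h : dyC n j k ⊆ dyC n j₀ k₀) : dyCDil n C j k ⊆ dyCDil n C j₀ k₀ := by
  intro x hx i
  have h1 := hx i
  obtain ⟨h2, h3⟩ := sub_bounds h i
  generalize (2 : ℝ) ^ (-j) = s at *
  generalize (2 : ℝ) ^ (-j₀) = s0 at *
  rw [abs_le] at h1 ⊢
  have : (C - 1) * (s0 - s) ≥ 0 := mul_nonneg (by linarith) (by linarith)
  constructor <;> nlinarith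

/-- lines with direction `e` that meet `S` -/
def tset {n : ℕ} (S : Set (EE n)) (e : EE n) : Set (EE n) :=
  {v | ⟪v, e⟫ = 0 ∧ (S ∩ cl (e, v)).Nonempty}

lemma tset_sub {n : ℕ} (S : Set (EE n)) (e : EE n) (he : ‖e‖ = 1) (w : EE n) (s : ℝ) (hs : 0 < s)
    (v : EE n) (hv : v ∈ tset S e) : (w - ⟪w, e⟫ • e) + s • v ∈ tset (w +ᵥ s • S) e := by
  obtain ⟨h1, x, hx, hl⟩ := hv
  have hee : ⟪e, e⟫ = (1 : ℝ) := by rw [real_inner_self_eq_norm_sq, he]; norm_num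
  refine ⟨?_, w + s • x, ?_, ?_⟩
  · simp [inner_add_left, inner_sub_left, inner_smul_left, h1, he]
  · exact ⟨s • x, ⟨x, hx, rfl⟩, rfl⟩
  · rw [← cl_eq _ _ he] at hl ⊢
    obtain ⟨r, rfl⟩ := hl
    refine ⟨s * r + ⟪w, e⟫, ?_⟩
    module

lemma tset_scale {n : ℕ} (S : Set (EE n)) (e : EE n) (he : ‖e‖ = 1) (w : EE n) (s : ℝ) (hs : 0 < s) :
    tset (w +ᵥ s • S) e = (w - ⟪w, e⟫ • e) +ᵥ (s • tset S e) := by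
  apply Set.Subset.antisymm
  · intro v hv
    have h := tset_sub _ e he (-(s⁻¹ • w)) s⁻¹ (inv_pos.2 hs) v hv
    have hS : (-(s⁻¹ • w)) +ᵥ s⁻¹ • (w +ᵥ s • S) = S := by
      ext x
      rw [Set.mem_vadd_set_iff_neg_vadd_mem, Set.mem_smul_set_iff_inv_smul_mem₀ (by positivity),
        Set.mem_vadd_set_iff_neg_vadd_mem, Set.mem_smul_set_iff_inv_smul_mem₀ (by positivity)]
      have : s⁻¹ • (-w +ᵥ s⁻¹⁻¹ • (- -(s⁻¹ • w) +ᵥ x)) = x := by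
        simp only [vadd_eq_add, neg_neg, inv_inv, smul_add, smul_neg, smul_smul,
          inv_mul_cancel₀ hs.ne', mul_inv_cancel₀ hs.ne', one_smul]
        abel
      rw [this]
    rw [hS] at h
    rw [Set.mem_vadd_set_iff_neg_vadd_mem, Set.mem_smul_set_iff_inv_smul_mem₀ hs.ne']
    convert h using 1
    simp only [vadd_eq_add, smul_add, smul_neg, smul_sub, inner_neg_left, inner_smul_left]
    simp [mul_smul]
    abel
  · rintro _ ⟨_, ⟨v, hv, rfl⟩, rfl⟩
    exact tset_sub S e he w s hs v hv

lemma h_scale {m : ℕ} (C : ℝ) (j : ℤ) (k : Fin (m + 1) → ℤ) (e : EE (m + 1)) (he : ‖e‖ = 1) :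
    μH[(m : ℝ)] (tset (dyCDil (m + 1) C j k) e) =
      ENNReal.ofReal (((2 : ℝ) ^ (-j)) ^ m) * μH[(m : ℝ)] (tset (dyCDil (m + 1) C 0 0) e) := by
  have hs : (0 : ℝ) < (2 : ℝ) ^ (-j) := by positivity
  rw [dil_eq, tset_scale _ e he _ _ hs, measure_vadd,
    Measure.hausdorffMeasure_smul₀ (by positivity) hs.ne']
  generalize (2 : ℝ) ^ (-j) = s at *
  rw [ENNReal.smul_def, smul_eq_mul]
  congr 1
  rw [NNReal.rpow_natCast, ENNReal.ofReal_pow hs.le, ENNReal.coe_pow]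
  congr 1
  rw [ENNReal.ofReal]
  congr 1
  ext
  simp [hs.le, abs_of_pos hs]

lemma tset_eq {n : ℕ} (S : Set (EE n)) (e : EE n) :
    tset S e = {p : (EE n) × (EE n) | (S ∩ cl p).Nonempty}.preimage (Prod.mk e) ∩
      {v | ⟪v, e⟫ = 0} := by
  ext v; simp [tset, and_comm]

lemma meas_ne {n : ℕ} (S : Set (EE n)) (hS : IsCompact S) :
    MeasurableSet {p : (EE n) × (EE n) | (S ∩ cl p).Nonempty} := by
  have := (isClosed_ex S Set.univ hS isClosed_univ).measurableSet
  simpa [Set.Nonempty] using this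

lemma tset_fin {m : ℕ} (S : Set (EE (m + 1))) (hS : IsCompact S) (e : EE (m + 1)) (he : ‖e‖ = 1) :
    μH[(m : ℝ)] (tset S e) < ⊤ := by
  obtain ⟨r, hr⟩ := hS.isBounded.exists_norm_le
  have hsub : tset S e ⊆ Metric.closedBall 0 r ∩ {v | ⟪v, e⟫ = 0} := by
    rintro v ⟨h1, x, hx, hl⟩
    refine ⟨?_, h1⟩
    rw [← cl_eq _ _ he] at hl
    obtain ⟨t, rfl⟩ := hl
    have h2 := hr _ hx
    rw [mem_closedBall_zero_iff]
    refine le_trans ?_ h2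
    have h3 : ‖v‖ * ‖v‖ ≤ ‖v + t • e‖ * ‖v + t • e‖ := by
      rw [norm_add_sq_eq_norm_sq_add_norm_sq_real (by rw [inner_smul_right, h1, mul_zero])]
      nlinarith [norm_nonneg (t • e)]
    nlinarith [norm_nonneg v, norm_nonneg (v + t • e)]
  refine lt_of_le_of_lt (measure_mono hsub) ?_
  rw [← Measure.restrict_apply Metric.isClosed_closedBall.measurableSet]
  exact ball_hyper e he r

/-- unit sphere -/
def sph (n : ℕ) : Set (EE n) := {e | ‖e‖ = 1}

lemma sph_meas (n : ℕ) : MeasurableSet (sph n) :=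
  (isClosed_eq (by fun_prop) (by fun_prop)).measurableSet

open Classical in
/-- squared beta number, cut off to lines meeting `S` -/
noncomputable def phi {n : ℕ} (f : (EE n) → ℝ) (S : Set (EE n)) (p : (EE n) × (EE n)) : ENNReal :=
  if (S ∩ cl p).Nonempty then ENNReal.ofReal (betaInfLine f S (cl p) ^ 2) else 0

lemma phi_meas {n : ℕ} (f : (EE n) → ℝ) (hf : Continuous f) (S : Set (EE n)) (hS : IsCompact S) :
    Measurable (phi f S) := by
  unfold phi
  exact Measurable.ite (meas_ne S hS) ((beta_meas f hf S hS).pow_const 2).ennreal_ofReal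
    measurable_const

/-- inner integral -/
noncomputable def JJ {m : ℕ} (f : (EE (m + 1)) → ℝ) (S : Set (EE (m + 1))) (e : EE (m + 1)) :
    ENNReal := ∫⁻ v in {v : EE (m + 1) | ⟪v, e⟫ = 0}, phi f S (e, v) ∂μH[(m : ℝ)]

lemma sph_ae {m : ℕ} {P : (EE (m + 1)) → Prop} (h : ∀ e, ‖e‖ = 1 → P e) :
    ∀ᵐ e ∂((μH[(m : ℝ)]).restrict (sph (m + 1))), P e := by
  filter_upwards [ae_restrict_mem (sph_meas (m + 1))] with e he using h e he

lemma JJ_aemeas {m : ℕ} (f : (EE (m + 1)) → ℝ) (hf : Continuous f) (S : Set (EE (m + 1)))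
    (hS : IsCompact S) : AEMeasurable (JJ f S) ((μH[(m : ℝ)]).restrict (sph (m + 1))) := by
  obtain ⟨g, hg, h⟩ := meas_param (phi f S) (phi_meas f hf S hS)
  exact ⟨g, hg, sph_ae h⟩

lemma tset_int {m : ℕ} (S : Set (EE (m + 1))) (hS : IsCompact S) (e : EE (m + 1)) :
    ∫⁻ v in {v : EE (m + 1) | ⟪v, e⟫ = 0},
      Set.indicator {p : (EE (m + 1)) × (EE (m + 1)) | (S ∩ cl p).Nonempty} 1 (e, v) ∂μH[(m : ℝ)]
      = μH[(m : ℝ)] (tset S e) := by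
  have hm : MeasurableSet (Prod.mk e ⁻¹' {p : (EE (m + 1)) × (EE (m + 1)) | (S ∩ cl p).Nonempty}) :=
    measurable_prodMk_left (meas_ne S hS)
  rw [tset_eq, ← Measure.restrict_apply hm, ← lintegral_indicator_one hm]
  rfl

lemma tset_aemeas {m : ℕ} (S : Set (EE (m + 1)))
    (hS : IsCompact S) : AEMeasurable (fun e => μH[(m : ℝ)] (tset S e))
      ((μH[(m : ℝ)]).restrict (sph (m + 1))) := by
  obtain ⟨g, hg, h⟩ := meas_param
    (Set.indicator {p : (EE (m + 1)) × (EE (m + 1)) | (S ∩ cl p).Nonempty} 1)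
    (measurable_one.indicator (meas_ne S hS))
  refine ⟨g, hg, sph_ae fun e he => ?_⟩
  rw [← h e he, tset_int S hS]

lemma JJ_le {m : ℕ} (f : (EE (m + 1)) → ℝ) (L : ℝ≥0) (hf : LipschitzWith L f)
    (S : Set (EE (m + 1))) (hS : IsCompact S) (hne : S.Nonempty) (e : EE (m + 1)) :
    JJ f S e ≤ ENNReal.ofReal ((L : ℝ) ^ 2) * μH[(m : ℝ)] (tset S e) := by
  rw [← tset_int S hS, ← lintegral_const_mul' _ _ ENNReal.ofReal_ne_top]
  refine lintegral_mono fun v => ?_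
  unfold phi
  split_ifs with h
  · rw [Set.indicator_of_mem (by exact h)]
    simp only [Pi.one_apply, mul_one]
    apply ENNReal.ofReal_le_ofReal
    exact pow_le_pow_left₀ (beta_nonneg _ _ _) (beta_le f L hf S _ hS.isBounded hne) 2
  · exact zero_le

lemma JJ_fin {m : ℕ} (f : (EE (m + 1)) → ℝ) (L : ℝ≥0) (hf : LipschitzWith L f)
    (S : Set (EE (m + 1))) (hS : IsCompact S) (hne : S.Nonempty) (e : EE (m + 1)) (he : ‖e‖ = 1) :
    JJ f S e < ⊤ :=
  (JJ_le f L hf S hS hne e).trans_lt (ENNReal.mul_lt_top ENNReal.ofReal_lt_top (tset_fin S hS e he))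

lemma line_set {n : ℕ} (S : Set (EE n)) (e : EE n) (he : ‖e‖ = 1) :
    {v : EE n | ⟪v, e⟫ = 0 ∧ (S ∩ lineThrough e v).Nonempty} = tset S e := by
  ext v
  simp only [tset, cl_eq _ _ he]

lemma eta_eq {m : ℕ} (S : Set (EE (m + 1))) (hS : IsCompact S) :
    etaLines S = (∫⁻ e in sph (m + 1), μH[(m : ℝ)] (tset S e) ∂μH[(m : ℝ)]).toReal := by
  unfold etaLines
  have hm : ((m + 1 : ℕ) : ℝ) - 1 = m := by push_cast; ring
  rw [hm, ← integral_toReal (tset_aemeas S hS) (sph_ae fun e he => tset_fin S hS e he)]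
  refine setIntegral_congr_fun (sph_meas _) fun e he => ?_
  simp only [line_set S e he]

lemma lbi_eq {m : ℕ} (f : (EE (m + 1)) → ℝ) (L : ℝ≥0) (hf : LipschitzWith L f)
    (S : Set (EE (m + 1))) (hS : IsCompact S) (hne : S.Nonempty) :
    lineBetaInt f S = (∫⁻ e in sph (m + 1), JJ f S e ∂μH[(m : ℝ)]).toReal := by
  unfold lineBetaInt
  have hm : ((m + 1 : ℕ) : ℝ) - 1 = m := by push_cast; ring
  rw [hm, ← integral_toReal (JJ_aemeas f hf.continuous S hS)
    (sph_ae fun e he => JJ_fin f L hf S hS hne e he)]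
  refine setIntegral_congr_fun (sph_meas _) fun e he => ?_
  have he' : ‖e‖ = 1 := he
  have hN : MeasurableSet (Prod.mk e ⁻¹' {p : (EE (m + 1)) × (EE (m + 1)) | (S ∩ cl p).Nonempty}) :=
    measurable_prodMk_left (meas_ne S hS)
  have hbm : Measurable fun v : EE (m + 1) => betaInfLine f S (cl (e, v)) ^ 2 :=
    ((beta_meas f hf.continuous S hS).comp measurable_prodMk_left).pow_const 2
  simp only [cl_eq _ _ he']
  change ∫ v in tset S e, betaInfLine f S (cl (e, v)) ^ 2 ∂μH[(m : ℝ)] = _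
  rw [integral_eq_lintegral_of_nonneg_ae (Filter.Eventually.of_forall fun v => by positivity)
    hbm.aestronglyMeasurable]
  congr 1
  rw [tset_eq, ← Measure.restrict_restrict hN, ← lintegral_indicator hN]
  unfold JJ phi
  refine lintegral_congr fun v => ?_
  by_cases h : (S ∩ cl (e, v)).Nonempty
  · rw [Set.indicator_of_mem (by exact h), if_pos h]
  · rw [Set.indicator_of_notMem (by exact h), if_neg h]

lemma line_bound {n : ℕ} (C : ℝ) (hC : 1 ≤ C) (K : ℝ) (L : ℝ≥0) (f : (EE n) → ℝ)
    (j₀ : ℤ) (k₀ : Fin n → ℤ) (e v : EE n) (he : ‖e‖ = 1)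
    (h : (∑' Q : {jk : ℤ × (Fin n → ℤ) // dyC n jk.1 jk.2 ⊆ dyC n j₀ k₀ ∧
                (dyCDil n C jk.1 jk.2 ∩ lineThrough e v).Nonempty},
              betaInfLine f (dyCDil n C Q.1.1 Q.1.2) (lineThrough e v) ^ 2 *
                Metric.diam (dyC n Q.1.1 Q.1.2))
              ≤ K * L * Metric.diam (dyC n j₀ k₀))
    (hfin : ∑' Q : {jk : ℤ × (Fin n → ℤ) // dyC n jk.1 jk.2 ⊆ dyC n j₀ k₀},
        ENNReal.ofReal (Metric.diam (dyC n Q.1.1 Q.1.2)) *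
          phi f (dyCDil n C Q.1.1 Q.1.2) (e, v) ≠ ⊤) :
    ∑' Q : {jk : ℤ × (Fin n → ℤ) // dyC n jk.1 jk.2 ⊆ dyC n j₀ k₀},
        ENNReal.ofReal (Metric.diam (dyC n Q.1.1 Q.1.2)) *
          phi f (dyCDil n C Q.1.1 Q.1.2) (e, v) ≤
      ENNReal.ofReal (K * L * Metric.diam (dyC n j₀ k₀)) *
        Set.indicator {p : (EE n) × (EE n) | (dyCDil n C j₀ k₀ ∩ cl p).Nonempty} 1 (e, v) := by
  by_cases hne : (dyCDil n C j₀ k₀ ∩ cl (e, v)).Nonempty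
  swap
  · rw [Set.indicator_of_notMem (by exact hne), mul_zero, nonpos_iff_eq_zero, ENNReal.tsum_eq_zero]
    intro Q
    rw [phi, if_neg, mul_zero]
    exact fun hh => hne (hh.mono (Set.inter_subset_inter_left _ (dil_mono hC Q.2)))
  rw [Set.indicator_of_mem (by exact hne)]
  simp only [Pi.one_apply, mul_one]
  rw [cl_eq e v he] at h
  -- the real sum
  set ι := {jk : ℤ × (Fin n → ℤ) // dyC n jk.1 jk.2 ⊆ dyC n j₀ k₀ ∧
                (dyCDil n C jk.1 jk.2 ∩ cl (e, v)).Nonempty} with hι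
  let i : ι → {jk : ℤ × (Fin n → ℤ) // dyC n jk.1 jk.2 ⊆ dyC n j₀ k₀} := fun Q => ⟨Q.1, Q.2.1⟩
  have hi : Function.Injective i := by
    intro a b hab
    apply Subtype.ext
    exact congrArg (fun q => q.1) hab
  set F : {jk : ℤ × (Fin n → ℤ) // dyC n jk.1 jk.2 ⊆ dyC n j₀ k₀} → ENNReal := fun Q =>
    ENNReal.ofReal (Metric.diam (dyC n Q.1.1 Q.1.2)) *
          phi f (dyCDil n C Q.1.1 Q.1.2) (e, v) with hF
  have hsupp : Function.support F ⊆ Set.range i := by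
    intro Q hQ
    refine ⟨⟨Q.1, Q.2, ?_⟩, rfl⟩
    by_contra hcon
    apply hQ
    simp only [hF]
    rw [phi, if_neg hcon, mul_zero]
  have h1 : ∑' Q : ι, F (i Q) = ∑' Q, F Q := hi.tsum_eq hsupp
  rw [← h1]
  have h2 : ∀ Q : ι, F (i Q) = ENNReal.ofReal (betaInfLine f (dyCDil n C Q.1.1 Q.1.2) (cl (e, v)) ^ 2 *
                Metric.diam (dyC n Q.1.1 Q.1.2)) := by
    intro Q
    simp only [hF, i]
    rw [phi, if_pos Q.2.2, ← ENNReal.ofReal_mul Metric.diam_nonneg, mul_comm]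
  rw [← h1] at hfin
  simp only [h2] at hfin ⊢
  have hsum : Summable fun Q : ι => betaInfLine f (dyCDil n C Q.1.1 Q.1.2) (cl (e, v)) ^ 2 *
                Metric.diam (dyC n Q.1.1 Q.1.2) := by
    have := ENNReal.summable_toReal hfin
    refine this.congr fun Q => ?_
    rw [ENNReal.toReal_ofReal (mul_nonneg (sq_nonneg _) Metric.diam_nonneg)]
  rw [← ENNReal.ofReal_tsum_of_nonneg (fun Q => mul_nonneg (sq_nonneg _) Metric.diam_nonneg) hsum]
  exact ENNReal.ofReal_le_ofReal h

lemma core {m : ℕ} (C : ℝ) (hC : 1 ≤ C) (K : ℝ) (L : ℝ≥0) (f : (EE (m + 1)) → ℝ)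
    (hf : LipschitzWith L f)
    (j₀ : ℤ) (k₀ : Fin (m + 1) → ℤ)
    (h : ∀ e v : EE (m + 1), ‖e‖ = 1 →
      (∑' Q : {jk : ℤ × (Fin (m + 1) → ℤ) // dyC (m + 1) jk.1 jk.2 ⊆ dyC (m + 1) j₀ k₀ ∧
                (dyCDil (m + 1) C jk.1 jk.2 ∩ lineThrough e v).Nonempty},
              betaInfLine f (dyCDil (m + 1) C Q.1.1 Q.1.2) (lineThrough e v) ^ 2 *
                Metric.diam (dyC (m + 1) Q.1.1 Q.1.2))
              ≤ K * L * Metric.diam (dyC (m + 1) j₀ k₀))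
    (hfin : ∑' Q : {jk : ℤ × (Fin (m + 1) → ℤ) // dyC (m + 1) jk.1 jk.2 ⊆ dyC (m + 1) j₀ k₀},
        ENNReal.ofReal (Metric.diam (dyC (m + 1) Q.1.1 Q.1.2)) *
          ∫⁻ e in sph (m + 1), JJ f (dyCDil (m + 1) C Q.1.1 Q.1.2) e ∂μH[(m : ℝ)] ≠ ⊤) :
    ∑' Q : {jk : ℤ × (Fin (m + 1) → ℤ) // dyC (m + 1) jk.1 jk.2 ⊆ dyC (m + 1) j₀ k₀},
        ENNReal.ofReal (Metric.diam (dyC (m + 1) Q.1.1 Q.1.2)) *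
          ∫⁻ e in sph (m + 1), JJ f (dyCDil (m + 1) C Q.1.1 Q.1.2) e ∂μH[(m : ℝ)] ≤
      ENNReal.ofReal (K * L * Metric.diam (dyC (m + 1) j₀ k₀)) *
        ∫⁻ e in sph (m + 1), μH[(m : ℝ)] (tset (dyCDil (m + 1) C j₀ k₀) e) ∂μH[(m : ℝ)] := by
  have hc := hf.continuous
  have hJm := fun Q : {jk : ℤ × (Fin (m + 1) → ℤ) // dyC (m + 1) jk.1 jk.2 ⊆ dyC (m + 1) j₀ k₀} =>
    (JJ_aemeas f hc _ (dil_compact (m + 1) C Q.1.1 Q.1.2)).const_mul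
      (ENNReal.ofReal (Metric.diam (dyC (m + 1) Q.1.1 Q.1.2)))
  simp only [← lintegral_const_mul' _ _ ENNReal.ofReal_ne_top] at hfin ⊢
  rw [← lintegral_tsum hJm] at hfin ⊢
  have hae := ae_lt_top' (AEMeasurable.ennreal_tsum hJm) hfin
  refine lintegral_mono_ae ?_
  filter_upwards [hae, ae_restrict_mem (sph_meas (m + 1))] with e he1 he
  have he' : ‖e‖ = 1 := he
  have hpm : ∀ Q : {jk : ℤ × (Fin (m + 1) → ℤ) // dyC (m + 1) jk.1 jk.2 ⊆ dyC (m + 1) j₀ k₀},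
      Measurable fun v => ENNReal.ofReal (Metric.diam (dyC (m + 1) Q.1.1 Q.1.2)) *
        phi f (dyCDil (m + 1) C Q.1.1 Q.1.2) (e, v) := fun Q =>
    (((phi_meas f hc _ (dil_compact (m + 1) C Q.1.1 Q.1.2)).comp
      (measurable_prodMk_left (x := e))).const_mul
      (ENNReal.ofReal (Metric.diam (dyC (m + 1) Q.1.1 Q.1.2))))
  rw [← tset_int _ (dil_compact (m + 1) C j₀ k₀)]
  simp only [JJ, ← lintegral_const_mul' _ _ ENNReal.ofReal_ne_top] at he1 ⊢
  rw [← lintegral_tsum fun Q => (hpm Q).aemeasurable] at he1 ⊢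
  have hae2 := ae_lt_top' (AEMeasurable.ennreal_tsum fun Q => (hpm Q).aemeasurable) he1.ne
  refine lintegral_mono_ae ?_
  filter_upwards [hae2] with v hv
  exact line_bound C hC K L f j₀ k₀ e v he' (h e v he') hv.ne

end BetaAux

/-- Carleson estimate for the integral-geometric coefficients `β¹_{∞,2}`: if the
one-dimensional Carleson estimate holds on every line with constant `K`, then
`Σ_{Q ⊆ Q₀} β¹_{∞,2}(CQ)² |Q| ≤ C'(K,C,n) · L · |Q₀|` for every dyadic cube `Q₀`, where
`β¹_{∞,2}(CQ)² = η₁(𝒜₁(CQ))⁻¹ ∫_{𝒜₁(CQ)} β_∞(CQ,ℓ)² dη₁(ℓ)`. -/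
theorem stmt15 (n : ℕ) (C : ℝ) (hC : 1 ≤ C) (K : ℝ) (hK : 0 < K) :
    ∃ C' : ℝ, 0 < C' ∧
      ∀ (L : ℝ≥0) (f : EuclideanSpace ℝ (Fin n) → ℝ), LipschitzWith L f →
        (∀ e v : EuclideanSpace ℝ (Fin n), ‖e‖ = 1 →
          ∀ (j₀ : ℤ) (k₀ : Fin n → ℤ),
            (∑' Q : {jk : ℤ × (Fin n → ℤ) // dyC n jk.1 jk.2 ⊆ dyC n j₀ k₀ ∧
                (dyCDil n C jk.1 jk.2 ∩ lineThrough e v).Nonempty},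
              betaInfLine f (dyCDil n C Q.1.1 Q.1.2) (lineThrough e v) ^ 2 *
                Metric.diam (dyC n Q.1.1 Q.1.2))
              ≤ K * L * Metric.diam (dyC n j₀ k₀)) →
      ∀ (j₀ : ℤ) (k₀ : Fin n → ℤ),
        (∑' Q : {jk : ℤ × (Fin n → ℤ) // dyC n jk.1 jk.2 ⊆ dyC n j₀ k₀},
          (etaLines (dyCDil n C Q.1.1 Q.1.2))⁻¹ *
            lineBetaInt f (dyCDil n C Q.1.1 Q.1.2) *
            (volume (dyC n Q.1.1 Q.1.2)).toReal)
          ≤ C' * L * (volume (dyC n j₀ k₀)).toReal := by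
  refine ⟨K, hK, ?_⟩
  intro L f hf h j₀ k₀
  have hRn : 0 ≤ K * L * (volume (dyC n j₀ k₀)).toReal :=
    mul_nonneg (mul_nonneg hK.le L.2) ENNReal.toReal_nonneg
  rcases n with _ | m
  · have h0 : ∀ S : Set (EuclideanSpace ℝ (Fin 0)), etaLines S = 0 := by
      intro S
      have he : {e : EuclideanSpace ℝ (Fin 0) | ‖e‖ = 1} = ∅ := by
        ext e
        simp [Subsingleton.elim e 0]
      unfold etaLines
      rw [he]
      simp
    simpa [h0] using hRn
  obtain ⟨N, hN⟩ : ∃ N, N = ∫⁻ e in BetaAux.sph (m + 1),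
    μH[(m : ℝ)] (BetaAux.tset (dyCDil (m + 1) C 0 0) e) ∂μH[(m : ℝ)] := ⟨_, rfl⟩
  have hNQ : ∀ (j : ℤ) (k : Fin (m + 1) → ℤ), ∫⁻ e in BetaAux.sph (m + 1),
      μH[(m : ℝ)] (BetaAux.tset (dyCDil (m + 1) C j k) e) ∂μH[(m : ℝ)] =
      ENNReal.ofReal (((2 : ℝ) ^ (-j)) ^ m) * N := by
    intro j k
    rw [hN, ← lintegral_const_mul' _ _ ENNReal.ofReal_ne_top]
    exact setLIntegral_congr_fun (BetaAux.sph_meas _) fun e he => BetaAux.h_scale C j k e he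
  have heta : ∀ (j : ℤ) (k : Fin (m + 1) → ℤ), etaLines (dyCDil (m + 1) C j k) =
      ((2 : ℝ) ^ (-j)) ^ m * N.toReal := by
    intro j k
    rw [BetaAux.eta_eq _ (BetaAux.dil_compact _ _ _ _), hNQ, ENNReal.toReal_mul,
      ENNReal.toReal_ofReal (by positivity)]
  by_cases hN0 : N.toReal = 0
  · simpa [heta, hN0] using hRn
  have hNtop : N ≠ ⊤ := by rintro rfl; simp at hN0
  have hNpos : 0 < N.toReal := lt_of_le_of_ne ENNReal.toReal_nonneg (Ne.symm hN0)
  have hD := BetaAux.diam_pos m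
  have hV0 : 0 ≤ (volume (dyC (m + 1) 0 0)).toReal := ENNReal.toReal_nonneg
  have hBtop : ∀ (j : ℤ) (k : Fin (m + 1) → ℤ), ∫⁻ e in BetaAux.sph (m + 1),
      BetaAux.JJ f (dyCDil (m + 1) C j k) e ∂μH[(m : ℝ)] ≠ ⊤ := by
    intro j k
    refine ne_of_lt (lt_of_le_of_lt (lintegral_mono fun e => BetaAux.JJ_le f L hf _
      (BetaAux.dil_compact _ _ _ _) (BetaAux.dil_nonempty _ _ hC _ _) e) ?_)
    rw [lintegral_const_mul' _ _ ENNReal.ofReal_ne_top, hNQ]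
    exact ENNReal.mul_lt_top ENNReal.ofReal_lt_top
      (ENNReal.mul_lt_top ENNReal.ofReal_lt_top hNtop.lt_top)
  have hlb : ∀ (j : ℤ) (k : Fin (m + 1) → ℤ), lineBetaInt f (dyCDil (m + 1) C j k) =
      (∫⁻ e in BetaAux.sph (m + 1),
        BetaAux.JJ f (dyCDil (m + 1) C j k) e ∂μH[(m : ℝ)]).toReal := fun j k =>
    BetaAux.lbi_eq f L hf _ (BetaAux.dil_compact _ _ _ _) (BetaAux.dil_nonempty _ _ hC _ _)
  by_cases hV : (volume (dyC (m + 1) 0 0)).toReal = 0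
  · have hv : ∀ (j : ℤ) (k : Fin (m + 1) → ℤ), (volume (dyC (m + 1) j k)).toReal = 0 := by
      intro j k
      rw [BetaAux.vol_eq, hV, mul_zero]
    simp [hv]
  have hVpos : 0 < (volume (dyC (m + 1) 0 0)).toReal := lt_of_le_of_ne hV0 (Ne.symm hV)
  set V := (volume (dyC (m + 1) 0 0)).toReal with hVd
  set D := Metric.diam (dyC (m + 1) 0 0) with hDd
  have hterm : ∀ (j : ℤ) (k : Fin (m + 1) → ℤ), (etaLines (dyCDil (m + 1) C j k))⁻¹ *
            lineBetaInt f (dyCDil (m + 1) C j k) * (volume (dyC (m + 1) j k)).toReal =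
      V / (N.toReal * D) * (Metric.diam (dyC (m + 1) j k) *
        lineBetaInt f (dyCDil (m + 1) C j k)) := by
    intro j k
    rw [heta, BetaAux.vol_eq, BetaAux.diam_eq, ← hVd, ← hDd]
    have hs : (0 : ℝ) < (2 : ℝ) ^ (-j) := by positivity
    generalize (2 : ℝ) ^ (-j) = s at *
    field_simp
    ring
  simp only [hterm]
  have hcpos : 0 < V / (N.toReal * D) := by positivity
  by_cases hsum : Summable fun Q : {jk : ℤ × (Fin (m + 1) → ℤ) //
      dyC (m + 1) jk.1 jk.2 ⊆ dyC (m + 1) j₀ k₀} =>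
      Metric.diam (dyC (m + 1) Q.1.1 Q.1.2) * lineBetaInt f (dyCDil (m + 1) C Q.1.1 Q.1.2)
  swap
  · rw [tsum_mul_left, tsum_eq_zero_of_not_summable hsum, mul_zero]
    exact hRn
  have hg0 : ∀ Q : {jk : ℤ × (Fin (m + 1) → ℤ) //
      dyC (m + 1) jk.1 jk.2 ⊆ dyC (m + 1) j₀ k₀}, 0 ≤
      Metric.diam (dyC (m + 1) Q.1.1 Q.1.2) * lineBetaInt f (dyCDil (m + 1) C Q.1.1 Q.1.2) := by
    intro Q
    rw [hlb]
    exact mul_nonneg Metric.diam_nonneg ENNReal.toReal_nonneg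
  have hof : ∀ Q : {jk : ℤ × (Fin (m + 1) → ℤ) //
      dyC (m + 1) jk.1 jk.2 ⊆ dyC (m + 1) j₀ k₀},
      ENNReal.ofReal (Metric.diam (dyC (m + 1) Q.1.1 Q.1.2)) *
          ∫⁻ e in BetaAux.sph (m + 1),
            BetaAux.JJ f (dyCDil (m + 1) C Q.1.1 Q.1.2) e ∂μH[(m : ℝ)] =
      ENNReal.ofReal (Metric.diam (dyC (m + 1) Q.1.1 Q.1.2) *
        lineBetaInt f (dyCDil (m + 1) C Q.1.1 Q.1.2)) := by
    intro Q
    rw [hlb, ENNReal.ofReal_mul Metric.diam_nonneg, ENNReal.ofReal_toReal (hBtop _ _)]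
  have hcore := BetaAux.core C hC K L f hf j₀ k₀ (fun e v he => h e v he j₀ k₀)
  simp only [hof] at hcore
  rw [← ENNReal.ofReal_tsum_of_nonneg hg0 hsum] at hcore
  have hA : 0 ≤ K * (L : ℝ) * Metric.diam (dyC (m + 1) j₀ k₀) :=
    mul_nonneg (mul_nonneg hK.le L.2) Metric.diam_nonneg
  have hc2 := hcore ENNReal.ofReal_ne_top
  rw [hNQ, ← ENNReal.ofReal_toReal hNtop, ← ENNReal.ofReal_mul (by positivity),
    ← ENNReal.ofReal_mul hA, ENNReal.ofReal_le_ofReal_iff (mul_nonneg hA (by positivity))] at hc2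
  rw [tsum_mul_left]
  refine (mul_le_mul_of_nonneg_left hc2 hcpos.le).trans (le_of_eq ?_)
  rw [BetaAux.vol_eq, BetaAux.diam_eq, ← hVd, ← hDd]
  have hs : (0 : ℝ) < (2 : ℝ) ^ (-j₀) := by positivity
  generalize (2 : ℝ) ^ (-j₀) = s at *
  field_simp
  try ring
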